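/- Let k ≥ 1 and let a = (a_1,…,a_s) be a tuple of nonzero integers. For every prime p and every integer n ≥ 0, M_a(p^n) = p^{−n}·φ(p^n)^s·Σ_{m=0}^{n} T_a(p^m). Consequently, if s ≥ 5 then the limit χ_p = lim_{n→∞} p^n φ(p^n)^{−s} M_a(p^n) exists and equals Σ_{m=0}^{∞} T_a(p^m). -/

import Mathlib

open scoped BigOperators Classical
open Filter MeasureTheory

noncomputable section

/-- `e(x) = e^{2πix}`. -/
def eC (x : ℝ) : ℂ := Complex.exp (2 * Real.pi * Complex.I * x)

/-- `W(q,r) = Σ_{h=1,…,q, (h;q)=1} e_q(r h^k)`. -/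
def Wsum (k q : ℕ) (r : ℤ) : ℂ :=
  ∑ h ∈ Finset.Icc 1 q,
    if Nat.gcd h q = 1 then eC (((r * (h : ℤ) ^ k : ℤ) : ℝ) / (q : ℝ)) else 0

/-- `T_a(q) = φ(q)^{-s} Σ_{r=1,…,q, (r;q)=1} ∏_j W(q, a_j r)`. -/
def Tsum (k : ℕ) {s : ℕ} (a : Fin s → ℤ) (q : ℕ) : ℂ :=
  ((Nat.totient q : ℂ))⁻¹ ^ s *
    ∑ r ∈ Finset.Icc 1 q,
      if Nat.gcd r q = 1 then ∏ j, Wsum k q (a j * r) else 0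

/-- `M_a(q)`: the number of tuples of units of `ℤ/qℤ` satisfying
`∑ a_j x_j^k ≡ 0 (mod q)`. -/
def Mcount (k : ℕ) {s : ℕ} (a : Fin s → ℤ) (q : ℕ) : ℕ :=
  Nat.card {x : Fin s → (ZMod q)ˣ | ∑ j, (a j : ZMod q) * ((x j : ZMod q)) ^ k = 0}

/-- The sum of `stdAddChar (c u ^ k)` over the units `u` of `ℤ/qℤ`. -/
def unitPowSum (k q : ℕ) [NeZero q] (c : ZMod q) : ℂ :=
  ∑ u : (ZMod q)ˣ, ZMod.stdAddChar (c * (u : ZMod q) ^ k)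

lemma map_sum_eq_prod {ι A M : Type*} [AddCommMonoid A] [CommMonoid M] (ψ : AddChar A M)
    (t : Finset ι) (f : ι → A) : ψ (∑ i ∈ t, f i) = ∏ i ∈ t, ψ (f i) := by
  induction t using Finset.induction_on with
  | empty => simp
  | insert i t hi ih => rw [Finset.sum_insert hi, Finset.prod_insert hi, ψ.map_add_eq_mul, ih]

lemma eC_intCast_div (q : ℕ) [NeZero q] (z : ℤ) :
    eC ((z : ℝ) / q) = ZMod.stdAddChar (z : ZMod q) := by
  rw [ZMod.stdAddChar_coe, eC]
  congr 1
  push_cast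
  ring

lemma sum_Icc_natCast_zmod (q : ℕ) [NeZero q] (F : ZMod q → ℂ) :
    ∑ h ∈ Finset.Icc 1 q, F (h : ZMod q) = ∑ x : ZMod q, F x := by
  have hinj : Set.InjOn (fun h : ℕ => (h : ZMod q)) (Finset.Icc 1 q : Finset ℕ) := by
    intro x hx y hy hxy
    simp only [Finset.coe_Icc, Set.mem_Icc] at hx hy
    have hmod : (x : ℤ) ≡ y [ZMOD q] :=
      Int.natCast_modEq_iff.2 ((ZMod.natCast_eq_natCast_iff x y q).1 hxy)
    have h0 := Int.eq_zero_of_abs_lt_dvd hmod.dvd (by rw [abs_lt]; omega)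
    omega
  rw [← Finset.sum_image hinj]
  congr 1
  apply Finset.eq_univ_of_card
  rw [Finset.card_image_of_injOn hinj]
  simp [ZMod.card]

lemma sum_Icc_coprime (q : ℕ) [NeZero q] (F : ZMod q → ℂ) :
    ∑ h ∈ Finset.Icc 1 q, (if Nat.gcd h q = 1 then F (h : ZMod q) else 0)
      = ∑ u : (ZMod q)ˣ, F u := by
  have h1 : ∀ h : ℕ, (if Nat.gcd h q = 1 then F (h : ZMod q) else 0)
      = (fun x : ZMod q => if IsUnit x then F x else 0) h := fun h => by
    simp only [ZMod.isUnit_iff_coprime, Nat.Coprime]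
  simp only [h1]
  rw [sum_Icc_natCast_zmod q (fun x : ZMod q => if IsUnit x then F x else 0),
    ← Finset.sum_filter]
  symm
  exact Finset.sum_bij (fun u _ => (u : ZMod q)) (fun u _ => by simp)
    (fun u _ v _ h => Units.ext h)
    (fun x hx => ⟨(Finset.mem_filter.1 hx).2.unit, Finset.mem_univ _, rfl⟩) (fun _ _ => rfl)

lemma Wsum_eq_unitPowSum (k q : ℕ) [NeZero q] (r : ℤ) :
    Wsum k q r = unitPowSum k q r := by
  rw [Wsum, unitPowSum, ← sum_Icc_coprime q (fun x => ZMod.stdAddChar ((r : ZMod q) * x ^ k))]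
  refine Finset.sum_congr rfl fun h _ => ?_
  rw [eC_intCast_div]
  push_cast
  rfl

lemma Tsum_eq (k : ℕ) {s : ℕ} (a : Fin s → ℤ) (q : ℕ) [NeZero q] :
    Tsum k a q = ((Nat.totient q : ℂ))⁻¹ ^ s *
      ∑ r : (ZMod q)ˣ, ∏ j, unitPowSum k q ((a j : ZMod q) * r) := by
  rw [Tsum, ← sum_Icc_coprime q (fun x => ∏ j, unitPowSum k q ((a j : ZMod q) * x))]
  simp only [Wsum_eq_unitPowSum]
  push_cast
  rfl

/-- The normalised sum of `∏ W(q, a_j r)` over all residues `r` modulo `q`. -/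
def fullSum (k : ℕ) {s : ℕ} (a : Fin s → ℤ) (q : ℕ) : ℂ :=
  ((Nat.totient q : ℂ))⁻¹ ^ s * ∑ r ∈ Finset.Icc 1 q, ∏ j, Wsum k q (a j * r)

lemma natCast_mul_Mcount (k : ℕ) {s : ℕ} (a : Fin s → ℤ) (q : ℕ) [NeZero q] :
    (q : ℂ) * Mcount k a q = ∑ r ∈ Finset.Icc 1 q, ∏ j, Wsum k q (a j * r) := by
  have hcard : (Mcount k a q : ℂ) = ∑ x : Fin s → (ZMod q)ˣ,
      if ∑ j, (a j : ZMod q) * ((x j : ZMod q)) ^ k = 0 then (1 : ℂ) else 0 := by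
    rw [Mcount, Nat.card_eq_fintype_card, Fintype.card_subtype, Finset.sum_boole]
    rfl
  have hW : ∀ r : ℕ, ∏ j, Wsum k q (a j * r)
      = (fun x : ZMod q => ∏ j, unitPowSum k q ((a j : ZMod q) * x)) r := fun r => by
    simp only [Wsum_eq_unitPowSum]
    push_cast
    rfl
  simp only [hW]
  rw [sum_Icc_natCast_zmod q (fun x : ZMod q => ∏ j, unitPowSum k q ((a j : ZMod q) * x)), hcard]
  simp only [unitPowSum, Finset.prod_univ_sum, Fintype.piFinset_univ]
  rw [Finset.sum_comm, Finset.mul_sum]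
  refine Finset.sum_congr rfl fun x _ => ?_
  have hx : ∀ r : ZMod q, ∏ j, ZMod.stdAddChar ((a j : ZMod q) * r * (x j : ZMod q) ^ k)
      = ZMod.stdAddChar (r * ∑ j, (a j : ZMod q) * (x j : ZMod q) ^ k) := fun r => by
    rw [Finset.mul_sum, map_sum_eq_prod]
    exact Finset.prod_congr rfl fun j _ => by ring_nf
  simp only [hx]
  rw [AddChar.sum_mulShift _ (ZMod.isPrimitive_stdAddChar q), ZMod.card]
  split_ifs <;> simp

lemma totient_mul_sum_unitsMap {m n : ℕ} [NeZero m] [NeZero n] (h : m ∣ n)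
    (F : (ZMod m)ˣ → ℂ) :
    (Nat.totient m : ℂ) * ∑ u : (ZMod n)ˣ, F (ZMod.unitsMap h u)
      = Nat.totient n * ∑ v : (ZMod m)ˣ, F v := by
  have hs := ZMod.unitsMap_surjective h
  set c := (Finset.univ.filter fun u : (ZMod n)ˣ => ZMod.unitsMap h u = 1).card with hc
  have hfib : ∀ v : (ZMod m)ˣ,
      (Finset.univ.filter fun u : (ZMod n)ˣ => ZMod.unitsMap h u = v).card = c := fun v =>
    MonoidHom.card_fiber_eq_of_mem_range (ZMod.unitsMap h) (hs v) (hs 1)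
  have hsum : ∀ G : (ZMod m)ˣ → ℂ,
      ∑ u : (ZMod n)ˣ, G (ZMod.unitsMap h u) = c * ∑ v, G v := fun G => by
    rw [← Finset.sum_fiberwise (s := Finset.univ) (g := ZMod.unitsMap h), Finset.mul_sum]
    refine Finset.sum_congr rfl fun v _ => ?_
    rw [Finset.sum_congr rfl (g := fun _ => G v)
      (fun u hu => by rw [(Finset.mem_filter.1 hu).2]), Finset.sum_const, hfib, nsmul_eq_mul]
  have hone := hsum fun _ => 1
  simp only [Finset.sum_const, Finset.card_univ, ZMod.card_units_eq_totient, nsmul_eq_mul,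
    mul_one] at hone
  rw [hsum, hone]
  ring

lemma stdAddChar_mul_left (p N : ℕ) [NeZero N] [NeZero (p * N)] (z : ℤ) :
    ZMod.stdAddChar ((p * z : ℤ) : ZMod (p * N)) = ZMod.stdAddChar (z : ZMod N) := by
  have hp : (p : ℂ) ≠ 0 := Nat.cast_ne_zero.2 (left_ne_zero_of_mul (NeZero.ne (p * N)))
  have hN : (N : ℂ) ≠ 0 := Nat.cast_ne_zero.2 (NeZero.ne N)
  rw [ZMod.stdAddChar_coe, ZMod.stdAddChar_coe]
  congr 1
  push_cast
  field_simp

lemma totient_mul_Wsum_mul_left (k p N : ℕ) [NeZero N] [NeZero (p * N)] (r : ℤ) :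
    (Nat.totient N : ℂ) * Wsum k (p * N) (p * r) = Nat.totient (p * N) * Wsum k N r := by
  rw [Wsum_eq_unitPowSum, Wsum_eq_unitPowSum, unitPowSum, unitPowSum,
    ← totient_mul_sum_unitsMap (Nat.dvd_mul_left N p)]
  congr 1
  refine Finset.sum_congr rfl fun u _ => ?_
  have hu : ((ZMod.unitsMap (Nat.dvd_mul_left N p) u : (ZMod N)ˣ) : ZMod N)
      = (((u : ZMod (p * N)).val : ℤ) : ZMod N) := by
    rw [ZMod.unitsMap_val, ← ZMod.natCast_val]
    push_cast
    rfl
  have h := stdAddChar_mul_left p N (r * ((u : ZMod (p * N)).val : ℤ) ^ k)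
  rw [hu]
  push_cast at h ⊢
  rw [← h, ZMod.natCast_zmod_val, mul_assoc]

lemma fullSum_pow_succ (k : ℕ) {s : ℕ} (a : Fin s → ℤ) {p : ℕ} (hp : p.Prime) (n : ℕ) :
    fullSum k a (p ^ (n + 1)) = fullSum k a (p ^ n) + Tsum k a (p ^ (n + 1)) := by
  have hN : NeZero (p ^ n) := ⟨pow_ne_zero _ hp.ne_zero⟩
  have hpN : NeZero (p * p ^ n) := ⟨mul_ne_zero hp.ne_zero hN.ne⟩
  have hgcd : ∀ r, Nat.gcd r (p * p ^ n) = 1 ↔ ¬ p ∣ r := fun r => by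
    rw [← pow_succ', ← Nat.coprime_iff_gcd_eq_one, Nat.coprime_pow_right_iff n.succ_pos,
      Nat.coprime_comm, hp.coprime_iff_not_dvd]
  have hφ : (Nat.totient (p ^ n) : ℂ) ≠ 0 :=
    Nat.cast_ne_zero.2 (Nat.totient_pos.2 (NeZero.pos _)).ne'
  have hφ' : (Nat.totient (p * p ^ n) : ℂ) ≠ 0 :=
    Nat.cast_ne_zero.2 (Nat.totient_pos.2 (NeZero.pos _)).ne'
  have hsplit : ∑ r ∈ Finset.Icc 1 (p * p ^ n), ∏ j, Wsum k (p * p ^ n) (a j * r)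
      = ∑ r ∈ Finset.Icc 1 (p ^ n), ∏ j, Wsum k (p * p ^ n) (p * (a j * r))
        + ∑ r ∈ Finset.Icc 1 (p * p ^ n),
          if Nat.gcd r (p * p ^ n) = 1 then ∏ j, Wsum k (p * p ^ n) (a j * r) else 0 := by
    rw [← Finset.sum_filter_add_sum_filter_not _ (fun r => p ∣ r)]
    congr 1
    · symm
      refine Finset.sum_bij (fun r _ => p * r) ?_ ?_ ?_ ?_
      · intro r hr
        simp only [Finset.mem_Icc, Finset.mem_filter, dvd_mul_right, and_true] at hr ⊢
        exact ⟨Nat.mul_pos hp.pos hr.1, Nat.mul_le_mul_left p hr.2⟩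
      · intro x _ y _ h
        exact Nat.eq_of_mul_eq_mul_left hp.pos h
      · intro y hy
        simp only [Finset.mem_Icc, Finset.mem_filter] at hy
        obtain ⟨⟨h1, h2⟩, x, rfl⟩ := hy
        exact ⟨x, Finset.mem_Icc.2
          ⟨Nat.pos_of_mul_pos_left h1, Nat.le_of_mul_le_mul_left h2 hp.pos⟩, rfl⟩
      · intro r _
        push_cast
        simp only [mul_left_comm]
    · rw [Finset.sum_filter]
      exact Finset.sum_congr rfl fun r _ => by simp only [hgcd]
  have hW : ∀ r : ℤ, Wsum k (p * p ^ n) (p * r)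
      = Nat.totient (p * p ^ n) * (Nat.totient (p ^ n) : ℂ)⁻¹ * Wsum k (p ^ n) r := fun r => by
    have := totient_mul_Wsum_mul_left k p (p ^ n) r
    field_simp
    linear_combination this
  rw [pow_succ', fullSum, fullSum, Tsum, hsplit, mul_add]
  congr 1
  simp only [hW, Finset.prod_mul_distrib, Finset.prod_const, Finset.card_univ, Fintype.card_fin]
  rw [← Finset.mul_sum, ← mul_assoc, inv_pow, inv_mul_cancel_left₀ (pow_ne_zero s hφ')]

lemma fullSum_pow (k : ℕ) {s : ℕ} (a : Fin s → ℤ) {p : ℕ} (hp : p.Prime) (n : ℕ) :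
    fullSum k a (p ^ n) = ∑ m ∈ Finset.range (n + 1), Tsum k a (p ^ m) := by
  induction n with
  | zero => simp [fullSum, Tsum]
  | succ n ih => rw [Finset.sum_range_succ, fullSum_pow_succ k a hp, ih]

lemma unitPowSum_eq_zero {k p m : ℕ} (hp : p.Prime) [NeZero (p ^ m)] {c : ℤ}
    (h : ¬ (p : ℤ) ^ (m / 2) ∣ c * k) (r : (ZMod (p ^ m))ˣ) :
    unitPowSum k (p ^ m) ((c : ZMod (p ^ m)) * r) = 0 := by
  set l := m - m / 2 with hl
  have hm : m ≠ 0 := by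
    rintro rfl
    simp at h
  have hpm : (p : ZMod (p ^ m)) ^ m = 0 := by
    exact_mod_cast ZMod.natCast_self (p ^ m)
  have hsq : ((p : ZMod (p ^ m)) ^ l) ^ 2 = 0 := by
    rw [← pow_mul]
    exact pow_eq_zero_of_le (by omega) hpm
  have hne : (c : ZMod (p ^ m)) * k * (p : ZMod (p ^ m)) ^ l ≠ 0 := by
    intro h0
    have h1 : ((c * k * (p : ℤ) ^ l : ℤ) : ZMod (p ^ m)) = 0 := by
      push_cast
      exact h0
    rw [ZMod.intCast_zmod_eq_zero_iff_dvd] at h1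
    push_cast at h1
    rw [show (p : ℤ) ^ m = (p : ℤ) ^ (m / 2) * (p : ℤ) ^ l by
      rw [← pow_add]
      congr 1
      omega] at h1
    exact h ((mul_dvd_mul_iff_right (pow_ne_zero _ (by exact_mod_cast hp.ne_zero))).1 h1)
  have hunit : ∀ x : ZMod (p ^ m), IsUnit (1 + (p : ZMod (p ^ m)) ^ l * x) := fun x =>
    IsNilpotent.isUnit_one_add ⟨2, by rw [mul_pow, hsq, zero_mul]⟩
  have hshift : ∀ x : ZMod (p ^ m), unitPowSum k (p ^ m) ((c : ZMod (p ^ m)) * r)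
      = ∑ u : (ZMod (p ^ m))ˣ,
        ZMod.stdAddChar (N := p ^ m) ((c : ZMod (p ^ m)) * r * (u : ZMod (p ^ m)) ^ k) * ZMod.stdAddChar (N := p ^ m) (x * ((c : ZMod (p ^ m)) * k * (p : ZMod (p ^ m)) ^ l
          * ((r : ZMod (p ^ m)) * (u : ZMod (p ^ m)) ^ k))) := fun x => by
    rw [unitPowSum, ← Equiv.sum_comp (Equiv.mulRight (hunit x).unit)]
    refine Finset.sum_congr rfl fun u _ => ?_
    obtain ⟨d, hd⟩ := Polynomial.powAddExpansion (1 : ZMod (p ^ m)) (p ^ l * x) k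
    rw [mul_pow _ x, hsq] at hd
    rw [← AddChar.map_add_eq_mul]
    congr 1
    simp only [Equiv.coe_mulRight, Units.val_mul, IsUnit.unit_spec, mul_pow, hd]
    simp only [one_pow]
    ring
  have hsum : ∑ _x : ZMod (p ^ m), unitPowSum k (p ^ m) ((c : ZMod (p ^ m)) * r) = 0 := by
    rw [Finset.sum_congr rfl fun x _ => hshift x, Finset.sum_comm]
    refine Finset.sum_eq_zero fun u _ => ?_
    rw [← Finset.mul_sum, AddChar.sum_mulShift _ (ZMod.isPrimitive_stdAddChar (p ^ m)),
      if_neg (fun h0 => hne ((r.isUnit.mul (u.isUnit.pow k)).mul_left_eq_zero.1 h0)), Nat.cast_zero, mul_zero]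
  rw [Finset.sum_const, Finset.card_univ, nsmul_eq_mul, ZMod.card] at hsum
  exact (mul_eq_zero.1 hsum).resolve_left (Nat.cast_ne_zero.2 (NeZero.ne _))

lemma Tsum_pow_eq_zero {k s : ℕ} (hk : 1 ≤ k) {a : Fin s → ℤ} {j : Fin s} (ha : a j ≠ 0)
    {p : ℕ} (hp : p.Prime) {m : ℕ} (hm : 2 * (a j * k).natAbs ≤ m) :
    Tsum k a (p ^ m) = 0 := by
  have : NeZero (p ^ m) := ⟨pow_ne_zero _ hp.ne_zero⟩
  have hne : a j * k ≠ 0 := mul_ne_zero ha (by exact_mod_cast (by omega : k ≠ 0))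
  have h : ¬ (p : ℤ) ^ (m / 2) ∣ a j * k := fun hd => by
    have h1 := Int.natAbs_dvd_natAbs.2 hd
    rw [Int.natAbs_pow, Int.natAbs_natCast] at h1
    have h2 := Nat.le_of_dvd (Int.natAbs_pos.2 hne) h1
    have h3 : m / 2 < p ^ (m / 2) := Nat.lt_pow_self hp.one_lt
    omega
  rw [Tsum_eq, Finset.sum_eq_zero, mul_zero]
  exact fun r _ => Finset.prod_eq_zero (Finset.mem_univ j) (unitPowSum_eq_zero hp h r)

theorem stmt16 (k s : ℕ) (hk : 1 ≤ k)
    (a : Fin s → ℤ) (ha : ∀ j, a j ≠ 0) (p : ℕ) (hp : p.Prime) :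
    (∀ n : ℕ, (Mcount k a (p ^ n) : ℂ)
        = ((p : ℂ) ^ n)⁻¹ * (Nat.totient (p ^ n) : ℂ) ^ s *
            ∑ m ∈ Finset.range (n + 1), Tsum k a (p ^ m)) ∧
    (5 ≤ s → Filter.Tendsto (fun n : ℕ =>
        (p : ℂ) ^ n * ((Nat.totient (p ^ n) : ℂ))⁻¹ ^ s * (Mcount k a (p ^ n) : ℂ))
      Filter.atTop (nhds (∑' m : ℕ, Tsum k a (p ^ m)))) := by
  have hφ : ∀ n, (Nat.totient (p ^ n) : ℂ) ≠ 0 := fun n =>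
    Nat.cast_ne_zero.2 (Nat.totient_pos.2 (pow_pos hp.pos n)).ne'
  have hpow : ∀ n, (p : ℂ) ^ n ≠ 0 := fun n => pow_ne_zero _ (Nat.cast_ne_zero.2 hp.ne_zero)
  have hcount : ∀ n, (p : ℂ) ^ n * ((Nat.totient (p ^ n) : ℂ))⁻¹ ^ s * (Mcount k a (p ^ n) : ℂ)
      = ∑ m ∈ Finset.range (n + 1), Tsum k a (p ^ m) := fun n => by
    have : NeZero (p ^ n) := ⟨pow_ne_zero _ hp.ne_zero⟩
    rw [← fullSum_pow k a hp, fullSum, ← natCast_mul_Mcount]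
    push_cast
    ring
  refine ⟨fun n => ?_, fun hs => ?_⟩
  · rw [← hcount]
    have h1 := hφ n
    have h2 := hpow n
    rw [inv_pow]
    field_simp
  · have hT : ∀ m ∉ Finset.range (2 * (a ⟨0, by omega⟩ * k).natAbs), Tsum k a (p ^ m) = 0 :=
      fun m hm => Tsum_pow_eq_zero hk (ha _) hp (by simpa using hm)
    simp only [hcount]
    exact (tendsto_add_atTop_iff_nat 1).2
      (summable_of_ne_finset_zero hT).hasSum.tendsto_sum_nat
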